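/- arXiv:2408.02818 — 2 statements merged into one kernel-verified Lean document; each statement's English description precedes it below -/
import Mathlib

section
/- Let G be a finite group, p a prime, and suppose the conjugacy class of every p-element of G has p-power size. Then G = P × O_{p'}(G) where P is a Sylow p-subgroup of G; in particular G has a normal Sylow p-subgroup and a normal p-complement. -/
open Subgroup MulAction in
theorem Subgroup.exists_mul_eq_of_coprime_index {G : Type*} [Group G] [Finite G]
    {H K : Subgroup G} (hHK : H.index.Coprime K.index) (g : G) :
    ∃ h ∈ H, ∃ k ∈ K, h * k = g := by
  have hdvd : H.index ∣ H.relIndex K := by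
    refine hHK.dvd_of_dvd_mul_right ?_
    rw [← inf_relIndex_right, relIndex_mul_index inf_le_right]
    exact index_dvd_of_le inf_le_left
  have hstab : stabilizer K ((1 : G) : G ⧸ H) = H.subgroupOf K := by
    ext k
    rw [mem_stabilizer_iff, mem_subgroupOf]
    change ((k * 1 : G) : G ⧸ H) = ((1 : G) : G ⧸ H) ↔ _
    rw [eq_comm, QuotientGroup.eq]
    simp
  have horb : orbit K ((1 : G) : G ⧸ H) = Set.univ := by
    apply Set.eq_of_subset_of_ncard_le (Set.subset_univ _)
    rw [← index_stabilizer, hstab, Set.ncard_univ]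
    exact Nat.le_of_dvd (Nat.pos_of_ne_zero index_ne_zero_of_finite) hdvd
  obtain ⟨k, hk⟩ : ((g⁻¹ : G) : G ⧸ H) ∈ orbit K ((1 : G) : G ⧸ H) := horb ▸ Set.mem_univ _
  change ((k * 1 : G) : G ⧸ H) = _ at hk
  rw [QuotientGroup.eq, mul_one] at hk
  refine ⟨g * k, ?_, (k : G)⁻¹, K.inv_mem k.2, by group⟩
  simpa using H.inv_mem hk

theorem Subgroup.mem_of_coprime_index_orderOf {G : Type*} [Group G] {H : Subgroup G} [H.Normal]
    {g : G} (hg : H.index.Coprime (orderOf g)) : g ∈ H := by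
  obtain ⟨m, hm⟩ := exists_pow_eq_self_of_coprime hg
  exact hm ▸ H.pow_mem (H.pow_index_mem g) m

theorem Subgroup.index_centralizer_singleton {G : Type*} [Group G] (x : G) :
    (centralizer {x}).index = Nat.card {y : G | IsConj x y} := by
  have h : (MulAction.stabilizer (ConjAct G) x).index = _ := MulAction.index_stabilizer _ x
  rw [ConjAct.stabilizer_eq_centralizer, ← Nat.card_coe_set_eq] at h
  have horb : MulAction.orbit (ConjAct G) x = {y : G | IsConj x y} := by
    ext y
    exact ConjAct.mem_orbit_conjAct.trans isConj_comm
  rw [horb] at h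
  exact h

/-- A subgroup of a finite `p`-group that meets every conjugacy class is the whole group. -/
theorem IsPGroup.eq_top_of_forall_exists_conj_mem {P : Type*} [Group P] [Finite P] {p : ℕ}
    [Fact p.Prime] (hP : IsPGroup p P) {H : Subgroup P}
    (hH : ∀ x : P, ∃ u : P, u * x * u⁻¹ ∈ H) : H = ⊤ := by
  by_contra hne
  obtain ⟨M, hM, hHM⟩ := (eq_top_or_exists_le_coatom H).resolve_left hne
  have := hP.isNilpotent
  have hnormal : M.Normal :=
    Subgroup.NormalizerCondition.normal_of_coatom M Group.normalizerCondition_of_isNilpotent hM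
  refine hM.1 (eq_top_iff.2 fun x _ => ?_)
  obtain ⟨u, hu⟩ := hH x
  simpa [mul_assoc] using hnormal.conj_mem _ (hHM hu) u⁻¹

/-- A `q`-subgroup acting on a coset space of order prime to `q` fixes a point. -/
theorem IsPGroup.exists_conj_mem_of_not_dvd_index {G : Type*} [Group G] {q : ℕ} [Fact q.Prime]
    {S : Subgroup G} (hS : IsPGroup q S) {H : Subgroup G} (hH : ¬ q ∣ H.index) :
    ∃ g : G, ∀ s ∈ S, g⁻¹ * s * g ∈ H := by
  obtain ⟨a, ha⟩ := hS.nonempty_fixed_point_of_prime_not_dvd_card (G ⧸ H) hH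
  obtain ⟨g, rfl⟩ := QuotientGroup.mk_surjective a
  refine ⟨g, fun s hs => ?_⟩
  have h : ((g : G) : G ⧸ H) = ((s * g : G) : G ⧸ H) := (ha ⟨s, hs⟩).symm
  simpa [mul_assoc] using QuotientGroup.eq.1 h

/-- If the `p`-elements have centralizers of `p`-power index, then every Sylow `p`-subgroup
is normal. -/
theorem Sylow.normal_of_index_centralizer {G : Type*} [Group G] [Finite G] {p : ℕ}
    [hp : Fact p.Prime] (P : Sylow p G)
    (h : ∀ x ∈ P, ∃ m : ℕ, (Subgroup.centralizer {x}).index = p ^ m) :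
    (P : Subgroup G).Normal := by
  refine ⟨fun x hx g => ?_⟩
  obtain ⟨m, hm⟩ := h x hx
  have hcop : (P : Subgroup G).index.Coprime (Subgroup.centralizer {x}).index :=
    hm ▸ (((Nat.Prime.coprime_iff_not_dvd hp.out).2 P.not_dvd_index).pow_left m).symm
  obtain ⟨u, hu, c, hc, rfl⟩ := Subgroup.exists_mul_eq_of_coprime_index hcop g
  have hcx : c * x = x * c := (Subgroup.mem_centralizer_singleton_iff.1 hc)
  have : u * c * x * (u * c)⁻¹ = u * x * u⁻¹ := by
    rw [mul_assoc u c x, hcx]; group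
  rw [this]
  exact mul_mem (mul_mem hu hx) (inv_mem hu)

/-- If the elements of a Sylow `p`-subgroup `P` have centralizers of `p`-power index, then
`P` is centralized by every `q`-subgroup with `q ≠ p`. -/
theorem Sylow.le_centralizer_of_index_centralizer {G : Type*} [Group G] [Finite G] {p q : ℕ}
    [hp : Fact p.Prime] [hq : Fact q.Prime] (hqp : q ≠ p) (P : Sylow p G)
    (h : ∀ x ∈ P, ∃ m : ℕ, (Subgroup.centralizer {x}).index = p ^ m)
    {S : Subgroup G} (hS : IsPGroup q S) : S ≤ Subgroup.centralizer (P : Set G) := by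
  have htop : (Subgroup.centralizer (S : Set G)).subgroupOf P = ⊤ := by
    refine P.2.eq_top_of_forall_exists_conj_mem fun ⟨x, hx⟩ => ?_
    obtain ⟨m, hm⟩ := h x hx
    have hq' : ¬ q ∣ (Subgroup.centralizer {x}).index := fun hd =>
      hqp ((Nat.prime_dvd_prime_iff_eq hq.out hp.out).1 (hq.out.dvd_of_dvd_pow (hm ▸ hd)))
    obtain ⟨g, hg⟩ := hS.exists_conj_mem_of_not_dvd_index hq'
    have hcop : (P : Subgroup G).index.Coprime (Subgroup.centralizer {x}).index :=
      hm ▸ (((Nat.Prime.coprime_iff_not_dvd hp.out).2 P.not_dvd_index).pow_left m).symm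
    obtain ⟨u, hu, c, hc, rfl⟩ := Subgroup.exists_mul_eq_of_coprime_index hcop g
    refine ⟨⟨u, hu⟩, ?_⟩
    rw [Subgroup.mem_subgroupOf, Subgroup.mem_centralizer_iff]
    intro s hs
    have hsx : u⁻¹ * s * u ∈ Subgroup.centralizer {x} := by
      simpa [mul_assoc] using mul_mem (mul_mem hc (hg s hs)) (inv_mem hc)
    have hcomm : u⁻¹ * s * u * x = x * (u⁻¹ * s * u) :=
      Subgroup.mem_centralizer_singleton_iff.1 hsx
    change s * (u * x * u⁻¹) = u * x * u⁻¹ * s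
    calc s * (u * x * u⁻¹) = u * (u⁻¹ * s * u * x) * u⁻¹ := by group
      _ = u * x * u⁻¹ * s := by rw [hcomm]; group
  exact Subgroup.le_centralizer_iff.1 (Subgroup.subgroupOf_eq_top.1 htop)

theorem Sylow.exists_index_centralizer_eq_pow {G : Type*} [Group G] [Finite G] {p : ℕ}
    [hp : Fact p.Prime] (P : Sylow p G)
    (h : ∀ x ∈ P, ∃ m : ℕ, (Subgroup.centralizer {x}).index = p ^ m) :
    ∃ m : ℕ, (Subgroup.centralizer (P : Set G)).index = p ^ m := by
  refine ⟨_, Nat.eq_prime_pow_of_unique_prime_dvd Subgroup.index_ne_zero_of_finite ?_⟩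
  intro q hq hdvd
  by_contra hqp
  have : Fact q.Prime := ⟨hq⟩
  obtain ⟨S⟩ : Nonempty (Sylow q G) := inferInstance
  exact S.not_dvd_index (hdvd.trans (Subgroup.index_dvd_of_le
    (P.le_centralizer_of_index_centralizer hqp h S.2)))

/-- If every `p`-element of a finite group `G` has conjugacy class of `p`-power size, then
`G` is the (internal) direct product of a Sylow `p`-subgroup `P` and the `p'`-core
`Q = O_{p'}(G)`, the largest normal subgroup of order coprime to `p`. -/
theorem direct_product_of_p_power_class_sizes (G : Type*) [Group G] [Finite G]
    (p : ℕ) (hp : p.Prime)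
    (h : ∀ x : G, (∃ n : ℕ, orderOf x = p ^ n) →
      ∃ m : ℕ, Nat.card {y : G | IsConj x y} = p ^ m) :
    ∃ P Q : Subgroup G, P.Normal ∧ Q.Normal ∧
      IsPGroup p P ∧ ¬ p ∣ P.index ∧
      ¬ p ∣ Nat.card Q ∧ (∀ R : Subgroup G, R.Normal → ¬ p ∣ Nat.card R → R ≤ Q) ∧
      Disjoint P Q ∧ P ⊔ Q = ⊤ := by
  have : Fact p.Prime := ⟨hp⟩
  obtain ⟨P⟩ : Nonempty (Sylow p G) := inferInstance
  have hindex : ∀ x ∈ P, ∃ m : ℕ, (Subgroup.centralizer {x}).index = p ^ m := by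
    intro x hx
    obtain ⟨n, hn⟩ := IsPGroup.iff_orderOf.1 P.2 ⟨x, hx⟩
    rw [Subgroup.orderOf_mk] at hn
    obtain ⟨m, hm⟩ := h x ⟨n, hn⟩
    exact ⟨m, (Subgroup.index_centralizer_singleton x).trans hm⟩
  have hnormal : (P : Subgroup G).Normal := P.normal_of_index_centralizer hindex
  obtain ⟨K, hK⟩ := Subgroup.exists_right_complement'_of_coprime P.card_coprime_index
  have hcardK : ¬ p ∣ Nat.card K := hK.symm.index_eq_card ▸ P.not_dvd_index
  have hKC : K ≤ Subgroup.centralizer (P : Set G) := by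
    obtain ⟨m, hm⟩ := P.exists_index_centralizer_eq_pow hindex
    have : (Subgroup.centralizer (P : Set G)).Normal := inferInstanceAs
      (Subgroup.centralizer ((P : Subgroup G) : Set G)).Normal
    intro k hk
    apply Subgroup.mem_of_coprime_index_orderOf
    rw [hm]
    exact (((Nat.Prime.coprime_iff_not_dvd hp).2 hcardK).pow_left m).coprime_dvd_right
      (Subgroup.orderOf_dvd_natCard K hk)
  have hKnormal : K.Normal := by
    rw [← Subgroup.normalizer_eq_top_iff, eq_top_iff, ← hK.sup_eq_top]
    exact sup_le ((Subgroup.le_centralizer_iff.1 hKC).trans (Subgroup.centralizer_le_normalizer _))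
      Subgroup.le_normalizer
  refine ⟨P, K, hnormal, hKnormal, P.2, P.not_dvd_index, hcardK, fun R _ hR r hr => ?_,
    hK.disjoint, hK.sup_eq_top⟩
  apply Subgroup.mem_of_coprime_index_orderOf
  obtain ⟨n, hn⟩ := IsPGroup.iff_card.1 P.2
  rw [hK.index_eq_card, hn]
  exact (((Nat.Prime.coprime_iff_not_dvd hp).2 hR).pow_left n).coprime_dvd_right
    (Subgroup.orderOf_dvd_natCard R hr)
end

section
/- Let G be a finite group, H a subgroup, and suppose H/(H ∩ Z(G)) has prime power order, the quotient H/(H∩Z(G)) being a nontrivial q-group. If H = ⋃ of H∩Z(G) together with conjugacy classes a_1^H, …, a_n^H that are all conjugate in G (hence all of equal size), then H/(H∩Z(G)) is elementary abelian. Formally: if H is a finite q-group (q prime) and H is the union of Z with classes of pairwise equal size whose nonidentity elements are partitioned into H-classes all of the same size and containing elements all of the same order under the conjugation action extending to an overgroup, then H/Z(H) is elementary abelian — extract the key step: a finite q-group whose noncentral elements all have the same conjugacy class size in an overgroup G with H normalized appropriately and form a single G-class has elementary abelian central quotient. -/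
open Polynomial in
/-- If the average of a multiset of roots of unity is a nonzero algebraic integer, then all of
them are equal to it. -/
theorem Multiset.eq_of_isIntegral_average_of_pow_eq_one {s : Multiset ℂ} {N : ℕ} (hN : N ≠ 0)
    (hs : ∀ x ∈ s, x ^ N = 1) (hint : IsIntegral ℤ (s.sum / s.card)) (h0 : s.sum ≠ 0) :
    ∀ x ∈ s, x = s.sum / s.card := by
  have hcard : s.card ≠ 0 := by
    rw [Ne, Multiset.card_eq_zero]
    rintro rfl
    exact h0 rfl
  have hcard' : (s.card : ℂ) ≠ 0 := Nat.cast_ne_zero.mpr hcard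
  let K : IntermediateField ℚ ℂ := IntermediateField.adjoin ℚ {x | x ∈ s}
  have : Finite {x | x ∈ s} := s.finite_toSet
  have hfd : FiniteDimensional ℚ K := by
    refine IntermediateField.finiteDimensional_adjoin fun x hx => ?_
    refine ⟨X ^ N - 1, monic_X_pow_sub_C (1 : ℚ) hN, ?_⟩
    simp [hs x hx]
  have : NumberField K := { to_charZero := inferInstance, to_finiteDimensional := hfd }
  have hsK : ∀ x ∈ s, x ∈ K := fun x hx =>
    IntermediateField.subset_adjoin ℚ {x | x ∈ s} (show x ∈ {x | x ∈ s} from hx)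
  obtain ⟨t, ht⟩ : ∃ t : Multiset K, t.map (algebraMap K ℂ) = s :=
    CanLift.prf s hsK
  have hα : s.sum / s.card = algebraMap K ℂ (t.sum / t.card) := by
    simp [← ht, map_multiset_sum]
  have hα0 : s.sum / s.card ≠ 0 := div_ne_zero h0 hcard'
  have hφ : ∀ φ : K →+* ℂ, ‖φ (t.sum / t.card)‖ ≤ 1 := by
    intro φ
    have h1 : ‖(t.map φ).sum‖ ≤ t.card := by
      refine (norm_multiset_sum_le _).trans ?_
      have : (t.map φ).map norm = t.map fun _ => (1 : ℝ) := by
        rw [Multiset.map_map]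
        refine Multiset.map_congr rfl fun x hx => ?_
        refine Complex.norm_eq_one_of_pow_eq_one (n := N) ?_ hN
        rw [← map_pow, show x ^ N = 1 from (algebraMap K ℂ).injective ?_, map_one]
        rw [map_pow, map_one]
        exact hs _ (ht ▸ Multiset.mem_map_of_mem _ hx)
      rw [this]
      simp
    rw [map_div₀, map_multiset_sum, map_natCast, norm_div, Complex.norm_natCast]
    exact div_le_one_of_le₀ h1 (by positivity)
  obtain ⟨m, hm, hpow⟩ := NumberField.Embeddings.pow_eq_one_of_norm_le_one K ℂ
    (x := t.sum / t.card) (by intro h; exact hα0 (by rw [hα, h]; exact RingHom.map_zero _))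
    (by
      rw [hα] at hint
      exact (isIntegral_algebraMap_iff (algebraMap K ℂ).injective).mp hint) hφ
  have hα1 : ‖s.sum / s.card‖ = 1 := Complex.norm_eq_one_of_pow_eq_one
    (by rw [hα, ← map_pow, hpow, map_one]) hm.ne'
  set α := s.sum / s.card with hαdef
  have hsum : s.sum = s.card * α := by rw [hαdef]; field_simp
  have hαα : α * starRingEnd ℂ α = 1 := by
    rw [Complex.mul_conj, Complex.normSq_eq_norm_sq, hα1]; simp
  let f : ℂ →+ ℝ := Complex.reAddGroupHom.comp (AddMonoidHom.mulRight (starRingEnd ℂ α))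
  have hf : ∀ x, f x = (x * starRingEnd ℂ α).re := fun _ => rfl
  have hnorm : ∀ x ∈ s, ‖x * starRingEnd ℂ α‖ = 1 := fun x hx => by
    rw [norm_mul, Complex.norm_conj, hα1, mul_one,
      Complex.norm_eq_one_of_pow_eq_one (hs x hx) hN]
  have hle : ∀ x ∈ s, f x ≤ 1 := fun x hx =>
    (Complex.re_le_norm _).trans (hnorm x hx).le
  have hsumf : (s.map f).sum = (s.map fun _ => (1 : ℝ)).sum := by
    rw [← map_multiset_sum, hsum, hf, mul_assoc, hαα]
    simp
  intro x hx
  have hx1 : f x = 1 := by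
    obtain ⟨u, rfl⟩ := Multiset.exists_cons_of_mem hx
    have hu : (u.map f).sum ≤ (u.map fun _ => (1 : ℝ)).sum :=
      Multiset.sum_map_le_sum_map _ _ fun y hy => hle y (Multiset.mem_cons_of_mem hy)
    have := hle x hx
    simp only [Multiset.map_cons, Multiset.sum_cons] at hsumf
    linarith
  have hx2 : x * starRingEnd ℂ α = 1 := by
    rw [hf] at hx1
    have h3 := Complex.sq_norm_sub_sq_re (x * starRingEnd ℂ α)
    rw [hnorm x hx, hx1] at h3
    apply Complex.ext
    · simpa using hx1
    · have : (x * starRingEnd ℂ α).im ^ 2 = 0 := by linarith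
      simpa using this
  calc x = x * (α * starRingEnd ℂ α) := by rw [hαα, mul_one]
    _ = x * starRingEnd ℂ α * α := by ring
    _ = α := by rw [hx2, one_mul]

open Polynomial in
theorem Matrix.eq_scalar_of_pow_eq_one_of_roots {n : Type*} [Fintype n] [DecidableEq n]
    {M : Matrix n n ℂ} {N : ℕ} (hN : N ≠ 0) (hM : M ^ N = 1) {c : ℂ}
    (hc : ∀ x ∈ M.charpoly.roots, x = c) : M = algebraMap ℂ _ c := by
  have hsq : Squarefree (X ^ N - 1 : ℂ[X]) :=
    (X_pow_sub_one_separable_iff.mpr (by exact_mod_cast hN)).squarefree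
  have hdvd : minpoly ℂ M ∣ X ^ N - 1 := minpoly.dvd _ _ (by simp [hM])
  have hchar : M.charpoly = (X - C c) ^ (Multiset.card M.charpoly.roots) := by
    conv_lhs => rw [(IsAlgClosed.splits M.charpoly).eq_prod_roots_of_monic M.charpoly_monic]
    rw [Multiset.map_congr rfl (g := fun _ => X - C c) fun x hx => by rw [hc x hx]]
    simp
  have h1 : minpoly ℂ M ∣ (X - C c) ^ (Multiset.card M.charpoly.roots + 1) :=
    (Matrix.minpoly_dvd_charpoly M).trans (by rw [pow_succ, ← hchar]; exact dvd_mul_right _ _)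
  have h2 := (Squarefree.dvd_pow_iff_dvd (hsq.squarefree_of_dvd hdvd) (Nat.succ_ne_zero _)).mp h1
  have h3 : aeval M (X - C c) = 0 := (minpoly.dvd_iff).mp h2
  simpa [sub_eq_zero] using h3

theorem Matrix.pow_eq_one_of_mem_roots_charpoly {n : Type*} [Fintype n] [DecidableEq n]
    {M : Matrix n n ℂ} {N : ℕ} (hM : M ^ N = 1) {x : ℂ} (hx : x ∈ M.charpoly.roots) :
    x ^ N = 1 := by
  have h1 : x ∈ spectrum ℂ M :=
    Matrix.mem_spectrum_iff_isRoot_charpoly.mpr (Polynomial.isRoot_of_mem_roots hx)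
  have h2 := spectrum.pow_mem_pow M N h1
  rw [hM] at h2
  have : Nontrivial (Matrix n n ℂ) := by
    by_contra h
    rw [not_nontrivial_iff_subsingleton] at h
    simp [spectrum.of_subsingleton] at h1
  simpa [spectrum.one_eq] using h2

theorem Matrix.eq_scalar_of_isIntegral_trace_div {n : Type*} [Fintype n] [DecidableEq n]
    {M : Matrix n n ℂ} {N : ℕ} (hN : N ≠ 0) (hM : M ^ N = 1)
    (hint : IsIntegral ℤ (M.trace / Fintype.card n)) (h0 : M.trace ≠ 0) :
    ∃ c : ℂ, M = algebraMap ℂ _ c := by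
  have hcard : Multiset.card M.charpoly.roots = Fintype.card n := by
    rw [← M.charpoly_natDegree_eq_dim, (IsAlgClosed.splits M.charpoly).natDegree_eq_card_roots]
  rw [Matrix.trace_eq_sum_roots_charpoly] at h0 hint
  rw [← hcard] at hint
  exact ⟨_, Matrix.eq_scalar_of_pow_eq_one_of_roots hN hM
    (Multiset.eq_of_isIntegral_average_of_pow_eq_one hN
      (fun x hx => Matrix.pow_eq_one_of_mem_roots_charpoly hM hx) hint h0)⟩

theorem Matrix.isIntegral_trace_of_pow_eq_one {n : Type*} [Fintype n] [DecidableEq n]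
    {M : Matrix n n ℂ} {N : ℕ} (hN : N ≠ 0) (hM : M ^ N = 1) : IsIntegral ℤ M.trace := by
  rw [Matrix.trace_eq_sum_roots_charpoly]
  refine IsIntegral.multiset_sum fun x hx => ?_
  exact .of_pow (Nat.pos_of_ne_zero hN)
    (by rw [Matrix.pow_eq_one_of_mem_roots_charpoly hM hx]; exact isIntegral_one)

theorem isIntegral_sum_monoidHom {G A : Type*} [Group G] [Finite G] [Ring A] (ρ : G →* A)
    (s : Finset G) : IsIntegral ℤ (∑ x ∈ s, ρ x) := by
  have h : IsIntegral ℤ (∑ x ∈ s, MonoidAlgebra.of ℤ G x) := IsIntegral.of_finite ℤ _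
  simpa using h.map (MonoidAlgebra.lift ℤ A G ρ)

theorem commute_sum_of_conj_mem {G A : Type*} [Group G] [Semiring A] (ρ : G →* A)
    {s : Finset G} (hs : ∀ x ∈ s, ∀ h, h * x * h⁻¹ ∈ s) (h : G) :
    Commute (ρ h) (∑ x ∈ s, ρ x) := by
  rw [Commute, SemiconjBy, Finset.mul_sum, Finset.sum_mul]
  refine Finset.sum_bij' (fun x _ => h * x * h⁻¹) (fun x _ => h⁻¹ * x * h)
    (fun x hx => hs x hx h) (fun x hx => by simpa using hs x hx h⁻¹) ?_ ?_ ?_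
  · intros; group
  · intros; group
  · intro x _; rw [← map_mul, ← map_mul]; congr 1; group

/-- If the size of the conjugacy class of `g` is coprime to the degree of an irreducible complex
representation, then the character vanishes at `g` or `g` acts as a scalar. -/
theorem MonoidHom.trace_eq_zero_or_eq_scalar {G n : Type*} [Group G] [Finite G] [Fintype n]
    [DecidableEq n] [Nonempty n] (ρ : G →* Matrix n n ℂ)
    (hρ : ∀ M, (∀ h, Commute (ρ h) M) → ∃ c : ℂ, M = algebraMap ℂ _ c) (g : G)
    (hg : (Nat.card (ConjClasses.mk g).carrier).Coprime (Fintype.card n)) :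
    (ρ g).trace = 0 ∨ ∃ c : ℂ, ρ g = algebraMap ℂ _ c := by
  classical
  by_cases h0 : (ρ g).trace = 0
  · exact .inl h0
  refine .inr ?_
  have hpow : ρ g ^ Nat.card G = 1 := by rw [← map_pow, pow_card_eq_one', map_one]
  have hN : Nat.card G ≠ 0 := Nat.card_pos.ne'
  have hfin : (ConjClasses.mk g).carrier.Finite := Set.toFinite _
  let s : Finset G := hfin.toFinset
  have hmem : ∀ x, x ∈ s ↔ IsConj x g := fun x => by
    simp [s, ConjClasses.mem_carrier_iff_mk_eq, ConjClasses.mk_eq_mk_iff_isConj]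
  have hcard : s.card = Nat.card (ConjClasses.mk g).carrier :=
    (Set.ncard_eq_toFinset_card _ hfin).symm
  obtain ⟨c, hc⟩ := hρ _ (commute_sum_of_conj_mem ρ (s := s) fun x hx h => by
    rw [hmem] at hx ⊢
    exact (isConj_iff.mpr ⟨h, rfl⟩ : IsConj x (h * x * h⁻¹)).symm.trans hx)
  have hcint : IsIntegral ℤ c := by
    have := isIntegral_sum_monoidHom ρ s
    rw [hc] at this
    exact (isIntegral_algHom_iff ((Algebra.ofId ℂ (Matrix n n ℂ)).restrictScalars ℤ)
      (algebraMap ℂ (Matrix n n ℂ)).injective).mp this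
  have htr : ∀ x ∈ s, (ρ x).trace = (ρ g).trace := by
    intro x hx
    obtain ⟨h, rfl⟩ := isConj_iff.mp ((hmem x).mp hx)
    rw [map_mul, Matrix.trace_mul_comm, ← map_mul]
    simp
  have hkey : (s.card : ℂ) * (ρ g).trace = Fintype.card n * c := by
    have := congrArg Matrix.trace hc
    rw [Matrix.trace_sum, Finset.sum_congr rfl htr] at this
    simpa [Matrix.algebraMap_eq_diagonal, Matrix.trace_diagonal] using this
  refine Matrix.eq_scalar_of_isIntegral_trace_div hN hpow ?_ h0
  have hn : (Fintype.card n : ℂ) ≠ 0 := Nat.cast_ne_zero.mpr Fintype.card_ne_zero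
  rw [← hcard] at hg
  have hbez := congrArg (Int.cast (R := ℂ)) (Nat.gcd_eq_gcd_ab s.card (Fintype.card n))
  rw [hg] at hbez
  push_cast at hbez
  have : (ρ g).trace / Fintype.card n = c * (s.card.gcdA (Fintype.card n) : ℤ) +
      (ρ g).trace * (s.card.gcdB (Fintype.card n) : ℤ) := by
    field_simp
    linear_combination (ρ g).trace * hbez + (s.card.gcdA (Fintype.card n) : ℂ) * hkey
  rw [this]
  exact (hcint.mul (isIntegral_algebraMap (R := ℤ))).add
    ((Matrix.isIntegral_trace_of_pow_eq_one hN hpow).mul (isIntegral_algebraMap (R := ℤ)))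

theorem MonoidAlgebra.trace_mulLeft_of_ne_one {k G : Type*} [Field k] [Group G] [Finite G] {g : G}
    (hg : g ≠ 1) :
    LinearMap.trace k (MonoidAlgebra k G) (LinearMap.mulLeft k (MonoidAlgebra.of k G g)) = 0 := by
  classical
  have := Fintype.ofFinite G
  rw [LinearMap.trace_eq_matrix_trace k (MonoidAlgebra.basis G k), Matrix.trace]
  refine Finset.sum_eq_zero fun x _ => ?_
  rw [Matrix.diag_apply, LinearMap.toMatrix_apply]
  simp [MonoidAlgebra.basis, MonoidAlgebra.single_mul_single, hg]

theorem Matrix.trace_mulLeft_pi {k ι : Type*} [Field k] [Fintype ι] [DecidableEq ι] {d : ι → ℕ}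
    (x : Π i, Matrix (Fin (d i)) (Fin (d i)) k) :
    LinearMap.trace k (Π i, Matrix (Fin (d i)) (Fin (d i)) k) (LinearMap.mulLeft k x) =
      ∑ i, (d i : k) * (x i).trace := by
  rw [LinearMap.trace_eq_matrix_trace k
    (Pi.basis fun i => Matrix.stdBasis k (Fin (d i)) (Fin (d i))), Matrix.trace,
    Fintype.sum_sigma]
  refine Finset.sum_congr rfl fun i _ => ?_
  rw [Fintype.sum_prod_type]
  have : ∀ a b : Fin (d i), (LinearMap.toMatrix
      (Pi.basis fun i => Matrix.stdBasis k (Fin (d i)) (Fin (d i)))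
      (Pi.basis fun i => Matrix.stdBasis k (Fin (d i)) (Fin (d i)))
      (LinearMap.mulLeft k x)).diag ⟨i, a, b⟩ = x i a a := by
    intro a b
    rw [Matrix.diag_apply, LinearMap.toMatrix_apply]
    rw [Pi.basis_apply, Pi.basis_repr, Matrix.stdBasis_eq_single]
    change ((x * Pi.single i (Matrix.single a b 1) :
      Π i, Matrix (Fin (d i)) (Fin (d i)) k) i) a b = _
    simp
  simp_rw [this]
  simp [Matrix.trace, Finset.mul_sum]

theorem not_isIntegral_of_one_eq_prime_mul {p : ℕ} (hp : p.Prime) {x : ℂ} (hx : 1 = p * x) :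
    ¬ IsIntegral ℤ x := by
  intro h
  have hp0 : (p : ℂ) ≠ 0 := Nat.cast_ne_zero.mpr hp.ne_zero
  have hx' : x = algebraMap ℚ ℂ (p : ℚ)⁻¹ := by
    rw [map_inv₀, map_natCast, eq_comm]; exact inv_eq_of_mul_eq_one_right hx.symm
  rw [hx', isIntegral_algebraMap_iff (algebraMap ℚ ℂ).injective] at h
  obtain ⟨z, hz⟩ := IsIntegrallyClosed.isIntegral_iff.mp h
  have hpq : (p : ℚ) ≠ 0 := Nat.cast_ne_zero.mpr hp.ne_zero
  have : (p : ℤ) * z = 1 := by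
    have : (p : ℚ) * z = 1 := by rw [show (z : ℚ) = (p : ℚ)⁻¹ from hz]; field_simp
    exact_mod_cast this
  have := Int.isUnit_iff.mp (IsUnit.of_mul_eq_one _ this)
  have := hp.one_lt
  omega

/-- A nontrivial element whose conjugacy class has prime power size acts as a scalar in some
nontrivial complex representation. -/
theorem exists_rep_eq_scalar_of_card_conjClass_eq_prime_pow {G : Type*} [Group G] [Finite G]
    {p k : ℕ} (hp : p.Prime) {g : G} (hg : g ≠ 1)
    (hk : Nat.card (ConjClasses.mk g).carrier = p ^ k) :
    ∃ (d : ℕ) (_ : NeZero d) (ρ : G →* Matrix (Fin d) (Fin d) ℂ),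
      (∃ h, ρ h ≠ 1) ∧ ∃ c : ℂ, ρ g = algebraMap ℂ _ c := by
  classical
  have : NeZero (Nat.card G : ℂ) := ⟨Nat.cast_ne_zero.mpr Nat.card_pos.ne'⟩
  obtain ⟨r, d, hd, ⟨e⟩⟩ :=
    IsSemisimpleRing.exists_algEquiv_pi_matrix_of_isAlgClosed ℂ (MonoidAlgebra ℂ G)
  let π : ∀ i, MonoidAlgebra ℂ G →ₐ[ℂ] Matrix (Fin (d i)) (Fin (d i)) ℂ := fun i =>
    (Pi.evalAlgHom ℂ _ i).comp e.toAlgHom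
  have hπ : ∀ i x, π i x = e x i := fun _ _ => rfl
  let ρ : ∀ i, G →* Matrix (Fin (d i)) (Fin (d i)) ℂ := fun i =>
    (π i : MonoidAlgebra ℂ G →* _).comp (MonoidAlgebra.of ℂ G)
  have hρ : ∀ i h, ρ i h = e (MonoidAlgebra.of ℂ G h) i := fun _ _ => rfl
  have hsurj : ∀ i, Function.Surjective (π i) := fun i M =>
    ⟨e.symm (Pi.single i M), by simp [hπ]⟩
  have hschur : ∀ i M, (∀ h, Commute (ρ i h) M) → ∃ c : ℂ, M = algebraMap ℂ _ c := by
    intro i M hM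
    have hM' : ∀ y, Commute (π i y) M := by
      intro y
      induction y using MonoidAlgebra.induction_on with
      | of h => exact hM h
      | add x y hx hy => rw [map_add]; exact hx.add_left hy
      | smul c x hx => rw [map_smul]; exact hx.smul_left c
    have : M ∈ Set.center (Matrix (Fin (d i)) (Fin (d i)) ℂ) := by
      rw [Semigroup.mem_center_iff]
      intro N
      obtain ⟨y, rfl⟩ := hsurj i N
      exact hM' y
    rw [Matrix.center_eq_range] at this
    obtain ⟨c, rfl⟩ := this
    exact ⟨c, rfl⟩
  by_contra! hcon
  have hnontriv : ∀ i, (∃ h, ρ i h ≠ 1) → p ∣ d i ∨ (ρ i g).trace = 0 := by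
    intro i hi
    by_contra! h
    have := (ρ i).trace_eq_zero_or_eq_scalar (hschur i) g (by
      rw [hk, Fintype.card_fin]
      exact ((hp.coprime_iff_not_dvd).mpr h.1).pow_left k)
    obtain ⟨c, hc⟩ := this.resolve_left h.2
    exact hcon (d i) (hd i) (ρ i) hi c hc
  let ε : MonoidAlgebra ℂ G →ₐ[ℂ] ℂ := MonoidAlgebra.lift ℂ ℂ G 1
  have hε : ∀ i, (∀ h, ρ i h = 1) → ∀ x, π i x = algebraMap ℂ _ (ε x) := by
    intro i hi x
    have : π i = (Algebra.ofId ℂ _).comp ε := by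
      refine MonoidAlgebra.algHom_ext (fun h => ?_) (Subsingleton.elim _ _)
      change ρ i h = _
      rw [hi h]
      simp [ε]
    rw [this]
    rfl
  -- Exactly one Wedderburn component is the trivial representation.
  have huniq : ∀ i j, (∀ h, ρ i h = 1) → (∀ h, ρ j h = 1) → i = j := by
    intro i j hi hj
    by_contra hij
    have h1 := hε i hi (e.symm (Pi.single i 1))
    have h2 := hε j hj (e.symm (Pi.single i 1))
    rw [hπ, AlgEquiv.apply_symm_apply, Pi.single_eq_same] at h1
    rw [hπ, AlgEquiv.apply_symm_apply, Pi.single_eq_of_ne (Ne.symm hij)] at h2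
    rw [← map_zero (algebraMap ℂ _)] at h2
    rw [← (algebraMap ℂ (Matrix (Fin (d j)) (Fin (d j)) ℂ)).injective h2, map_zero] at h1
    exact one_ne_zero h1
  have := Fintype.ofFinite G
  obtain ⟨i₀, hi₀⟩ : ∃ i, ∀ h, ρ i h = 1 := by
    let s : MonoidAlgebra ℂ G := ∑ h, MonoidAlgebra.of ℂ G h
    have hs : s ≠ 0 := by
      intro h
      have : ε s = 0 := by rw [h, map_zero]
      simp [s, ε] at this
    have hes : e s ≠ 0 := fun h => hs (by simpa using h)
    obtain ⟨i, hi⟩ := Function.ne_iff.mp hes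
    refine ⟨i, fun h => ?_⟩
    have hmul : ∀ h, MonoidAlgebra.of ℂ G h * s = s := by
      intro h
      simp only [s, Finset.mul_sum, ← map_mul]
      exact Fintype.sum_equiv (Equiv.mulLeft h) _ _ fun _ => rfl
    have hcomm : ∀ h, Commute (ρ i h) (π i s) := by
      intro h
      have : s * MonoidAlgebra.of ℂ G h = s := by
        simp only [s, Finset.sum_mul, ← map_mul]
        exact Fintype.sum_equiv (Equiv.mulRight h) _ _ fun _ => rfl
      change π i _ * π i s = π i s * π i _
      rw [← map_mul, ← map_mul, hmul, this]
    obtain ⟨c, hc⟩ := hschur i _ hcomm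
    have hc0 : c ≠ 0 := by
      rintro rfl
      exact hi (by rw [← hπ, hc, map_zero]; rfl)
    have h1 : ρ i h * π i s = π i s := by
      change π i _ * π i s = π i s
      rw [← map_mul, hmul]
    rw [hc, Algebra.algebraMap_eq_smul_one, mul_smul_comm, mul_one] at h1
    exact smul_right_injective _ hc0 h1
  have hd₀ : d i₀ = 1 := by
    have hcard : Module.finrank ℂ (Matrix (Fin (d i₀)) (Fin (d i₀)) ℂ) ≤ Module.finrank ℂ ℂ :=
      LinearMap.finrank_le_finrank_of_surjective (f := Algebra.linearMap ℂ _) fun M => by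
        obtain ⟨x, rfl⟩ := hsurj i₀ M
        exact ⟨_, (hε i₀ hi₀ x).symm⟩
    simp [Module.finrank_matrix] at hcard
    have := (hd i₀).out
    nlinarith [Nat.pos_of_ne_zero this]
  have htrace : ∑ i, (d i : ℂ) * (ρ i g).trace = 0 := by
    rw [← MonoidAlgebra.trace_mulLeft_of_ne_one (k := ℂ) hg,
      ← LinearMap.trace_conj' _ e.toLinearEquiv]
    change _ = LinearMap.trace ℂ (Π i, Matrix (Fin (d i)) (Fin (d i)) ℂ) _
    rw [← Matrix.trace_mulLeft_pi fun i => ρ i g]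
    congr 1
    refine LinearMap.ext fun x => ?_
    change _ = e (MonoidAlgebra.of ℂ G g * e.symm x)
    rw [map_mul, AlgEquiv.apply_symm_apply]
    rfl
  rw [← Finset.add_sum_erase _ _ (Finset.mem_univ i₀), hi₀ g, Matrix.trace_one, Fintype.card_fin,
    hd₀] at htrace
  have hdiv : ∀ i ∈ Finset.univ.erase i₀, ∃ y, IsIntegral ℤ y ∧
      (d i : ℂ) * (ρ i g).trace = p * y := by
    intro i hi
    have hint : IsIntegral ℤ (ρ i g).trace :=
      Matrix.isIntegral_trace_of_pow_eq_one (N := Nat.card G) Nat.card_pos.ne'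
        (by rw [← map_pow, pow_card_eq_one', map_one])
    have hex : ∃ h, ρ i h ≠ 1 := by
      by_contra! h
      exact (Finset.mem_erase.mp hi).1 (huniq i i₀ h hi₀)
    rcases hnontriv i hex with ⟨m, hm⟩ | h
    · exact ⟨m * (ρ i g).trace, (isIntegral_algebraMap (R := ℤ) (x := (m : ℤ))).mul hint, by
        have hm' : (d i : ℂ) = p * m := by exact_mod_cast hm
        rw [hm', mul_assoc]⟩
    · exact ⟨0, isIntegral_zero, by rw [h]; simp⟩
  choose! y hy hy' using hdiv
  rw [Finset.sum_congr rfl hy', ← Finset.mul_sum] at htrace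
  refine not_isIntegral_of_one_eq_prime_mul hp (x := -∑ i ∈ Finset.univ.erase i₀, y i) ?_
    (IsIntegral.sum _ hy).neg
  push_cast at htrace
  linear_combination htrace

theorem IsSimpleGroup.center_eq_top_of_card_conjClass_eq_prime_pow {G : Type*} [Group G] [Finite G]
    [IsSimpleGroup G] {p k : ℕ} (hp : p.Prime) {g : G} (hg : g ≠ 1)
    (hk : Nat.card (ConjClasses.mk g).carrier = p ^ k) : Subgroup.center G = ⊤ := by
  obtain ⟨d, _, ρ, ⟨h, hh⟩, c, hc⟩ := exists_rep_eq_scalar_of_card_conjClass_eq_prime_pow hp hg hk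
  have hinj : Function.Injective ρ := by
    refine (MonoidHom.ker_eq_bot_iff ρ).mp
      ((IsSimpleGroup.eq_bot_or_eq_top_of_normal _ inferInstance).resolve_right fun htop => hh ?_)
    exact MonoidHom.mem_ker.mp (htop ▸ Subgroup.mem_top h)
  refine (IsSimpleGroup.eq_bot_or_eq_top_of_normal _ inferInstance).resolve_left fun hbot => hg ?_
  rw [← Subgroup.mem_bot, ← hbot, Subgroup.mem_center_iff]
  intro x
  apply hinj
  rw [map_mul, map_mul, hc]
  exact (Algebra.commutes c (ρ x)).symm

theorem card_conjClass_dvd_index {G : Type*} [Group G] {g : G} {K : Subgroup G}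
    (hK : ∀ x ∈ K, Commute x g) : Nat.card (ConjClasses.mk g).carrier ∣ K.index := by
  have h1 : Nat.card (ConjClasses.mk g).carrier = (MulAction.stabilizer (ConjAct G) g).index := by
    rw [MulAction.index_stabilizer, ConjAct.orbit_eq_carrier_conjClasses]
    rfl
  rw [h1, ← Subgroup.index_comap_of_surjective (MulAction.stabilizer (ConjAct G) g)
    (f := (ConjAct.toConjAct (G := G)).toMonoidHom) ConjAct.toConjAct.surjective]
  refine Subgroup.index_dvd_of_le fun x hx => ?_
  rw [Subgroup.mem_comap, MulAction.mem_stabilizer_iff]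
  change ConjAct.toConjAct x • g = g
  rw [ConjAct.toConjAct_smul, (hK x hx).eq, mul_inv_cancel_right]

theorem Group.isSolvable_extension {G : Type*} [Group G] (N : Subgroup G) [N.Normal]
    [Group.IsSolvable N] [Group.IsSolvable (G ⧸ N)] : Group.IsSolvable G :=
  Group.isSolvable_of_ker_le_range N.subtype (QuotientGroup.mk' N) (by simp)

/-- **Burnside's `p ^ a * q ^ b` theorem.** -/

theorem Group.isSolvable_of_prime_dvd_card {p q : ℕ} (hp : p.Prime) (hq : q.Prime)
    {G : Type*} [Group G] [Finite G]
    (hG : ∀ ℓ : ℕ, ℓ.Prime → ℓ ∣ Nat.card G → ℓ = p ∨ ℓ = q) : Group.IsSolvable G := by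
  induction hn : Nat.card G using Nat.strong_induction_on generalizing G with
  | _ n ih =>
  subst hn
  rcases subsingleton_or_nontrivial G with _ | _
  · infer_instance
  by_cases hsimple : IsSimpleGroup G
  · have key : Subgroup.center G = ⊤ := by
      have := Fact.mk hq
      obtain ⟨Q⟩ := (inferInstance : Nonempty (Sylow q G))
      by_cases hQ : Nontrivial Q
      · have := Q.isPGroup'.center_nontrivial
        obtain ⟨⟨⟨z, hzQ⟩, hz⟩, hz1⟩ := exists_ne (1 : Subgroup.center Q)
        have hz1' : z ≠ 1 := fun h => hz1 (by ext; exact h)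
        have hdvd : Nat.card (ConjClasses.mk z).carrier ∣ (Q : Subgroup G).index :=
          card_conjClass_dvd_index fun x hx =>
            congrArg Subtype.val (Subgroup.mem_center_iff.mp hz ⟨x, hx⟩)
        have hpos : Nat.card (ConjClasses.mk z).carrier ≠ 0 := fun h0 => by
          rw [h0, zero_dvd_iff] at hdvd
          exact Subgroup.FiniteIndex.index_ne_zero hdvd
        refine IsSimpleGroup.center_eq_top_of_card_conjClass_eq_prime_pow hp hz1'
          (Nat.eq_prime_pow_of_unique_prime_dvd hpos fun {ℓ} hℓ hℓd => ?_)
        have hℓQ := hℓd.trans hdvd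
        refine (hG ℓ hℓ (hℓQ.trans (Subgroup.index_dvd_card _))).resolve_right ?_
        rintro rfl
        exact Q.not_dvd_index hℓQ
      · have hqG : ¬ q ∣ Nat.card G := fun h =>
          hQ ((Subgroup.nontrivial_iff_ne_bot _).mpr (Q.ne_bot_of_dvd_card h))
        have := Fact.mk hp
        have hpG : IsPGroup p G := IsPGroup.of_card
          (Nat.eq_prime_pow_of_unique_prime_dvd Nat.card_pos.ne' fun {ℓ} hℓ hℓd =>
            (hG ℓ hℓ hℓd).resolve_right (by rintro rfl; exact hqG hℓd))
        exact (IsSimpleGroup.eq_bot_or_eq_top_of_normal _ inferInstance).resolve_left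
          hpG.bot_lt_center.ne'
    exact Group.isSolvable_of_comm fun a b =>
      (Subgroup.mem_center_iff.mp (key ▸ Subgroup.mem_top b) a)
  · obtain ⟨N, hN, hbot, htop⟩ : ∃ N : Subgroup G, N.Normal ∧ N ≠ ⊥ ∧ N ≠ ⊤ := by
      by_contra! h
      exact hsimple ⟨fun N hN => or_iff_not_imp_left.mpr (h N hN)⟩
    have hmul := N.card_mul_index
    have h1 : 1 < Nat.card N := N.one_lt_card_iff_ne_bot.mpr hbot
    have h2 : 1 < N.index := by
      have := N.index_ne_zero_of_finite
      have := mt Subgroup.index_eq_one.mp htop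
      omega
    have : Group.IsSolvable N := ih _ (by nlinarith)
      (fun ℓ hℓ hd => hG ℓ hℓ (hd.trans N.card_subgroup_dvd_card)) rfl
    have : Group.IsSolvable (G ⧸ N) := ih (Nat.card (G ⧸ N))
      (by rw [← Subgroup.index_eq_card]; nlinarith)
      (fun ℓ hℓ hd => hG ℓ hℓ (hd.trans N.card_quotient_dvd_card)) rfl
    exact Group.isSolvable_extension N

theorem Group.isSolvable_of_pow_mem_center {G : Type*} [Group G] [Finite G] {p q : ℕ}
    (hp : p.Prime) (hq : q.Prime) {H : Subgroup G}
    (hH : ∀ ℓ : ℕ, ℓ.Prime → ℓ ∣ H.index → ℓ = p)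
    (hpow : ∀ x ∈ H, x ^ q ∈ Subgroup.center G) : Group.IsSolvable G := by
  have : Group.IsSolvable (G ⧸ Subgroup.center G) := by
    refine Group.isSolvable_of_prime_dvd_card hp hq fun ℓ hℓ hd => ?_
    rw [← Subgroup.index_eq_card] at hd
    have hd' : ℓ ∣ (Subgroup.center G).relIndex H * H.index := by
      rw [← Subgroup.inf_relIndex_right, Subgroup.relIndex_mul_index inf_le_right]
      exact hd.trans (Subgroup.index_dvd_of_le inf_le_left)
    refine (hℓ.dvd_mul.mp hd').symm.imp (hH ℓ hℓ) fun h => ?_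
    have := Fact.mk hℓ
    rw [Subgroup.relIndex, Subgroup.index_eq_card] at h
    obtain ⟨x, hx⟩ := exists_prime_orderOf_dvd_card' ℓ h
    refine (Nat.prime_dvd_prime_iff_eq hℓ hq).mp (hx ▸ orderOf_dvd_of_pow_eq_one ?_)
    obtain ⟨⟨y, hy⟩, rfl⟩ := QuotientGroup.mk_surjective x
    rw [← QuotientGroup.mk_pow, QuotientGroup.eq_one_iff, Subgroup.mem_subgroupOf]
    exact hpow y hy
  have : Group.IsSolvable (Subgroup.center G) :=
    Group.isSolvable_of_comm fun a b => Subtype.ext (Subgroup.mem_center_iff.mp b.2 a)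
  exact Group.isSolvable_extension (Subgroup.center G)

theorem Subgroup.exists_prime_pow_mem_of_notMem {G : Type*} [Group G] [Finite G]
    {N : Subgroup G} [N.Normal] {x : G} (hx : x ∉ N) :
    ∃ q : ℕ, q.Prime ∧ ∃ k : ℕ, x ^ k ∉ N ∧ (x ^ k) ^ q ∈ N := by
  have hne : orderOf (x : G ⧸ N) ≠ 1 := by
    rwa [Ne, orderOf_eq_one_iff, QuotientGroup.eq_one_iff]
  obtain ⟨q, hq, m, hm⟩ := Nat.exists_prime_and_dvd hne
  have hpos := orderOf_pos (x : G ⧸ N)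
  refine ⟨q, hq, m, fun h => ?_, ?_⟩
  · rw [← QuotientGroup.eq_one_iff, QuotientGroup.mk_pow] at h
    have hm0 : 0 < m := Nat.pos_of_ne_zero (by rintro rfl; omega)
    have := Nat.le_of_dvd hm0 (orderOf_dvd_of_pow_eq_one h)
    nlinarith [hq.two_le]
  · rw [← pow_mul, mul_comm, ← hm, ← QuotientGroup.eq_one_iff, QuotientGroup.mk_pow,
      pow_orderOf_eq_one]

theorem Subgroup.Normal.mem_of_isConj {G : Type*} [Group G] {N : Subgroup G} (hN : N.Normal)
    {x y : G} (h : IsConj x y) (hx : x ∈ N) : y ∈ N := by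
  obtain ⟨c, rfl⟩ := isConj_iff.mp h
  exact hN.conj_mem x hx c

/-- If `G` is a finite group, `p` a prime, `H` a `p`-complement (Hall `p'`-subgroup) of `G`,
and `G` has exactly one noncentral conjugacy class of `p`-regular elements, then
`H/(H ∩ Z(G))` is elementary abelian (its commutators and `q`-th powers, for some prime `q`,
land in `Z(G)`). -/
theorem p_complement_central_quotient_elementary_abelian (G : Type*) [Group G] [Finite G]
    (p : ℕ) (hp : p.Prime) (H : Subgroup G)
    (hH₁ : ¬ p ∣ Nat.card H) (hH₂ : ∀ ℓ : ℕ, ℓ.Prime → ℓ ∣ H.index → ℓ = p)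
    (a : G) (ha₁ : ¬ p ∣ orderOf a) (ha₂ : a ∉ Subgroup.center G)
    (huniq : ∀ b : G, ¬ p ∣ orderOf b → b ∉ Subgroup.center G → IsConj a b) :
    (∀ x y : G, x ∈ H → y ∈ H → x * y * x⁻¹ * y⁻¹ ∈ Subgroup.center G) ∧
    ∃ q : ℕ, q.Prime ∧ ∀ x ∈ H, x ^ q ∈ Subgroup.center G := by
  have hconj : ∀ x ∈ H, x ∉ Subgroup.center G → IsConj a x := fun x hx hxZ =>
    huniq x (fun h => hH₁ (h.trans (Subgroup.orderOf_dvd_natCard H hx))) hxZ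
  have hZ : (Subgroup.center G).Normal := inferInstance
  obtain ⟨q, hq, hpow⟩ : ∃ q : ℕ, q.Prime ∧ ∀ x ∈ H, x ^ q ∈ Subgroup.center G := by
    by_cases hle : H ≤ Subgroup.center G
    · exact ⟨2, Nat.prime_two, fun x hx => pow_mem (hle hx) 2⟩
    obtain ⟨x₀, hx₀, hx₀Z⟩ := SetLike.not_le_iff_exists.mp hle
    obtain ⟨q, hq, k, hk, hkq⟩ := Subgroup.exists_prime_pow_mem_of_notMem hx₀Z
    refine ⟨q, hq, fun x hx => ?_⟩
    by_cases hxZ : x ∈ Subgroup.center G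
    · exact pow_mem hxZ q
    · exact hZ.mem_of_isConj
        (((hconj _ (pow_mem hx₀ k) hk).symm.trans (hconj x hx hxZ)).pow q) hkq
  refine ⟨fun x y hx hy => ?_, q, hq, hpow⟩
  have hsol : Group.IsSolvable G := Group.isSolvable_of_pow_mem_center hp hq hH₂ hpow
  obtain ⟨m, ham, ham'⟩ : ∃ m, a ∈ derivedSeries G m ∧ a ∉ derivedSeries G (m + 1) := by
    by_contra! h
    obtain ⟨n, hn⟩ := hsol.solvable
    have han : a ∈ derivedSeries G n := Nat.rec (Subgroup.mem_top a) h n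
    rw [hn, Subgroup.mem_bot] at han
    exact ha₂ (han ▸ one_mem _)
  by_cases hxZ : x ∈ Subgroup.center G
  · rw [← Subgroup.mem_center_iff.mp hxZ y, mul_inv_cancel_right, mul_inv_cancel]
    exact one_mem _
  by_cases hyZ : y ∈ Subgroup.center G
  · rw [Subgroup.mem_center_iff.mp hyZ x, mul_inv_cancel_right, mul_inv_cancel]
    exact one_mem _
  by_contra hc
  have hN := derivedSeries_normal G m
  refine ham' ((derivedSeries_normal G (m + 1)).mem_of_isConj (hconj _ (mul_mem (mul_mem
    (mul_mem hx hy) (inv_mem hx)) (inv_mem hy)) hc).symm ?_)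
  exact Subgroup.commutator_mem_commutator (hN.mem_of_isConj (hconj x hx hxZ) ham)
    (hN.mem_of_isConj (hconj y hy hyZ) ham)
end
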